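/- Let α > 0 with α ≠ 1, let 0 < a ≤ b, let I ≥ 1 and T ≥ 1, and let u₁,…,u_T ∈ ℝ^I be vectors with a ≤ u_{t,i} ≤ b for all t and i. Then Σ_{i=1}^I f_α( (1/T)·Σ_{t=1}^T u_{t,i} ) = min over θ ∈ [−a^{−α}, −b^{−α}]^I of (1/T)·Σ_{t=1}^T ( Σ_{i=1}^I g_α(θ_i) − ⟨θ, u_t⟩ ), and the minimum is attained. -/

import Mathlib

/-- The α-fairness function `f_α(u) = (u^{1−α} − 1)/(1−α)` (for `α ≠ 1`). -/
noncomputable def fAlpha (α u : ℝ) : ℝ := (u ^ (1 - α) - 1) / (1 - α)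

/-- The conjugate expression `g_α(θ) = (α·(−θ)^{1−1/α} − 1)/(1−α)` (for `α ≠ 1`, `θ < 0`). -/
noncomputable def gAlpha (α θ : ℝ) : ℝ := (α * (-θ) ^ (1 - 1 / α) - 1) / (1 - α)

/-- The power `(r ^ (1 - α) - 1) / (1 - α)` lies below its tangent line at `1`. -/
theorem fAlpha_le_sub_one {α r : ℝ} (hα : 0 < α) (hα1 : α ≠ 1) (hr : 0 < r) :
    fAlpha α r ≤ r - 1 := by
  unfold fAlpha
  rcases lt_or_gt_of_ne hα1 with h | h
  · rw [div_le_iff₀ (by linarith)]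
    have := Real.geom_mean_le_arith_mean2_weighted (sub_nonneg.2 h.le) hα.le hr.le zero_le_one
      (by ring)
    rw [Real.one_rpow] at this
    linarith
  · rw [div_le_iff_of_neg (by linarith)]
    have hw : 0 ≤ 1 - 1 / α := by
      rw [sub_nonneg, div_le_one hα]
      exact h.le
    have := Real.geom_mean_le_arith_mean2_weighted (one_div_nonneg.2 hα.le) hw
      (Real.rpow_nonneg hr.le (1 - α)) hr.le (by ring)
    rw [← Real.rpow_mul hr.le, ← Real.rpow_add hr,
      show (1 - α) * (1 / α) + (1 - 1 / α) = 0 by field_simp; ring, Real.rpow_zero] at this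
    have := mul_le_mul_of_nonneg_left this hα.le
    have e : α * (1 / α * r ^ (1 - α) + (1 - 1 / α) * r) = r ^ (1 - α) + (α - 1) * r := by
      field_simp
    linarith

theorem gAlpha_neg_rpow {α z : ℝ} (hα : 0 < α) (hz : 0 < z) :
    gAlpha α (-z ^ (-α)) = (α * z ^ (1 - α) - 1) / (1 - α) := by
  rw [gAlpha, neg_neg, ← Real.rpow_mul hz.le,
    show -α * (1 - 1 / α) = 1 - α by field_simp; ring]

theorem rpow_neg_mul_self {α x : ℝ} (hx : 0 < x) : x ^ (-α) * x = x ^ (1 - α) := by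
  rw [← Real.rpow_add_one hx.ne', neg_add_eq_sub]

theorem fAlpha_eq_gAlpha_sub {α x : ℝ} (hα : 0 < α) (hα1 : α ≠ 1) (hx : 0 < x) :
    fAlpha α x = gAlpha α (-x ^ (-α)) - -x ^ (-α) * x := by
  have h : 1 - α ≠ 0 := sub_ne_zero.2 hα1.symm
  rw [gAlpha_neg_rpow hα hx, neg_mul, rpow_neg_mul_self hx, fAlpha]
  field_simp
  ring

/-- The Fenchel inequality for the pair `fAlpha`, `gAlpha`. -/
theorem fAlpha_le_gAlpha_sub {α x θ : ℝ} (hα : 0 < α) (hα1 : α ≠ 1) (hx : 0 < x) (hθ : θ < 0) :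
    fAlpha α x ≤ gAlpha α θ - θ * x := by
  have h : 1 - α ≠ 0 := sub_ne_zero.2 hα1.symm
  obtain ⟨z, hz, rfl⟩ : ∃ z : ℝ, 0 < z ∧ -z ^ (-α) = θ := by
    refine ⟨(-θ) ^ (-α)⁻¹, Real.rpow_pos_of_pos (neg_pos.2 hθ) _, ?_⟩
    rw [Real.rpow_inv_rpow (neg_pos.2 hθ).le (neg_ne_zero.2 hα.ne'), neg_neg]
  have hzp : 0 < z ^ (1 - α) := Real.rpow_pos_of_pos hz _
  have key := mul_le_mul_of_nonneg_left (fAlpha_le_sub_one hα hα1 (div_pos hx hz)) hzp.le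
  have e₁ : z ^ (1 - α) * fAlpha α (x / z) = (x ^ (1 - α) - z ^ (1 - α)) / (1 - α) := by
    rw [fAlpha, Real.div_rpow hx.le hz.le]
    field_simp
  have e₂ : z ^ (1 - α) * (x / z - 1) = z ^ (-α) * x - z ^ (1 - α) := by
    rw [← rpow_neg_mul_self hz]
    field_simp
  rw [e₁, e₂] at key
  have e₃ : (x ^ (1 - α) - 1) / (1 - α) - (α * z ^ (1 - α) - 1) / (1 - α)
      = (x ^ (1 - α) - z ^ (1 - α)) / (1 - α) + z ^ (1 - α) := by
    field_simp
    ring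
  rw [gAlpha_neg_rpow hα hz, fAlpha]
  linarith

theorem average_proxy_eq_sum (α : ℝ) {I T : ℕ} (hT : 1 ≤ T) (u : ℕ → Fin I → ℝ)
    (θ : Fin I → ℝ) :
    (1 / T : ℝ) * ∑ t ∈ Finset.range T, ((∑ i, gAlpha α (θ i)) - ∑ i, θ i * u t i)
      = ∑ i, (gAlpha α (θ i) - θ i * ((1 / T : ℝ) * ∑ t ∈ Finset.range T, u t i)) := by
  have hT' : (T : ℝ) ≠ 0 := Nat.cast_ne_zero.2 (by lia)
  rw [Finset.sum_sub_distrib, Finset.sum_const, Finset.card_range, nsmul_eq_mul, mul_sub,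
    ← mul_assoc, one_div_mul_cancel hT', one_mul, Finset.sum_sub_distrib, Finset.sum_comm,
    Finset.mul_sum]
  congr 1
  refine Finset.sum_congr rfl fun i _ => ?_
  rw [← Finset.mul_sum, mul_left_comm]

/-- The α-fairness of a time-averaged utility vector equals the attained minimum, over the
dual box `[−a^{−α}, −b^{−α}]^I`, of the time-averaged proxy functions
`(1/T)·∑_t (∑_i g_α(θ_i) − ⟨θ, u_t⟩)`. Slots are indexed `0, …, T−1`. -/
theorem alpha_fairness_dual_box_representation
    (α : ℝ) (hα : 0 < α) (hα1 : α ≠ 1) (a b : ℝ) (ha : 0 < a) (hab : a ≤ b)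
    (I T : ℕ) (hI : 1 ≤ I) (hT : 1 ≤ T)
    (u : ℕ → Fin I → ℝ) (hu : ∀ t < T, ∀ i, a ≤ u t i ∧ u t i ≤ b) :
    IsLeast
      {v : ℝ | ∃ θ : Fin I → ℝ,
        (∀ i, θ i ∈ Set.Icc (-a ^ (-α)) (-b ^ (-α))) ∧
        v = (1 / T : ℝ) * ∑ t ∈ Finset.range T,
              ((∑ i, gAlpha α (θ i)) - ∑ i, θ i * u t i)}
      (∑ i, fAlpha α ((1 / T : ℝ) * ∑ t ∈ Finset.range T, u t i)) := by
  have hT' : (0 : ℝ) < T := Nat.cast_pos.2 hT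
  have hmean : ∀ i, a ≤ (1 / T : ℝ) * ∑ t ∈ Finset.range T, u t i ∧
      (1 / T : ℝ) * ∑ t ∈ Finset.range T, u t i ≤ b := by
    intro i
    have h₁ := Finset.card_nsmul_le_sum (Finset.range T) (fun t => u t i) a
      fun t ht => (hu t (Finset.mem_range.1 ht) i).1
    have h₂ := Finset.sum_le_card_nsmul (Finset.range T) (fun t => u t i) b
      fun t ht => (hu t (Finset.mem_range.1 ht) i).2
    rw [Finset.card_range, nsmul_eq_mul] at h₁ h₂
    rw [one_div_mul_eq_div, le_div_iff₀ hT', div_le_iff₀ hT', mul_comm a, mul_comm b]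
    exact ⟨h₁, h₂⟩
  have hpos := fun i => ha.trans_le (hmean i).1
  constructor
  · refine ⟨fun i => -((1 / T : ℝ) * ∑ t ∈ Finset.range T, u t i) ^ (-α), fun i => ?_, ?_⟩
    · have hn : -α ≤ 0 := neg_nonpos.2 hα.le
      exact ⟨neg_le_neg (Real.rpow_le_rpow_of_nonpos ha (hmean i).1 hn),
        neg_le_neg (Real.rpow_le_rpow_of_nonpos (hpos i) (hmean i).2 hn)⟩
    · rw [average_proxy_eq_sum α hT]
      exact Finset.sum_congr rfl fun i _ => fAlpha_eq_gAlpha_sub hα hα1 (hpos i)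
  · rintro v ⟨θ, hθ, rfl⟩
    rw [average_proxy_eq_sum α hT]
    refine Finset.sum_le_sum fun i _ => fAlpha_le_gAlpha_sub hα hα1 (hpos i) ?_
    exact (hθ i).2.trans_lt (neg_lt_zero.2 (Real.rpow_pos_of_pos (ha.trans_le hab) _))
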